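/- Let (W,S) be a Coxeter system of finite rank, I, J ⊆ S, and let C = W_I w W_J be a parabolic double coset whose minimal-length element is w. Let y ∈ C and fix a reduced factorization y = u w v with u ∈ W_I, v ∈ W_J, and ℓ(y) = ℓ(u) + ℓ(w) + ℓ(v). Then for every x ∈ W the following are equivalent: (i) x ∈ C and x ≤ y in Bruhat order; (ii) w ≤ x ≤ y in Bruhat order; (iii) x = u' w v' for some u' ≤ u and v' ≤ v in Bruhat order. -/

import Mathlib

open CoxeterSystem

variable {B : Type*} {W : Type*} [Group W]

/-- The standard parabolic subgroup `W_I` of a Coxeter system, generated by the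
simple reflections indexed by `I`. -/
def CoxeterSystem.parabolic {M : CoxeterMatrix B} (cs : CoxeterSystem M W) (I : Set B) :
    Subgroup W :=
  Subgroup.closure (cs.simple '' I)

/-- The parabolic double coset `W_I w W_J`. -/
def CoxeterSystem.doubleCoset {M : CoxeterMatrix B} (cs : CoxeterSystem M W) (I : Set B)
    (w : W) (J : Set B) : Set W :=
  {x | ∃ u ∈ cs.parabolic I, ∃ v ∈ cs.parabolic J, x = u * w * v}

/-- The Bruhat order on a Coxeter group: the partial order generated by the relations
`a < a * t` for reflections `t` with `ℓ(a) < ℓ(a * t)`. -/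
def CoxeterSystem.bruhatLE {M : CoxeterMatrix B} (cs : CoxeterSystem M W) (x y : W) : Prop :=
  Relation.ReflTransGen
    (fun a b => (∃ t : W, cs.IsReflection t ∧ b = a * t) ∧ cs.length a < cs.length b) x y

namespace CoxeterSystem

variable {M : CoxeterMatrix B} (cs : CoxeterSystem M W)

/-! ### The strong exchange property -/

open scoped Classical in
/-- The permutation `(t, e) ↦ (s t s, e + [t = s])` attached to the simple reflection `s`. -/
noncomputable def signedConj (i : B) : Equiv.Perm (W × ZMod 2) :=
  Function.Involutive.toPerm
    (fun p ↦ (cs.simple i * p.1 * cs.simple i, p.2 + if p.1 = cs.simple i then 1 else 0)) <| by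
    rintro ⟨t, e⟩
    have h : cs.simple i * t * cs.simple i = cs.simple i ↔ t = cs.simple i := by
      constructor
      · intro h
        have := congrArg (fun x ↦ cs.simple i * x * cs.simple i) h
        simpa [mul_assoc] using this
      · rintro rfl
        simp
    ext
    · simp [mul_assoc]
    · simp only [h, add_assoc]
      split_ifs <;> simp [CharTwo.add_self_eq_zero]

open scoped Classical in
theorem signedConj_apply (i : B) (t : W) (e : ZMod 2) :
    cs.signedConj i (t, e) =
      (cs.simple i * t * cs.simple i, e + if t = cs.simple i then 1 else 0) := rfl

open scoped Classical in
theorem prod_map_signedConj_apply (ω : List B) (t : W) (e : ZMod 2) :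
    (ω.map cs.signedConj).prod (t, e) =
      (cs.wordProd ω * t * (cs.wordProd ω)⁻¹, e + ((cs.rightInvSeq ω).count t : ℕ)) := by
  induction ω with
  | nil => simp
  | cons i ω ih =>
    have h : cs.wordProd ω * t * (cs.wordProd ω)⁻¹ = cs.simple i ↔
        (cs.wordProd ω)⁻¹ * cs.simple i * cs.wordProd ω = t := by
      constructor
      · intro h
        rw [← h]
        group
      · rintro rfl
        group
    rw [List.map_cons, List.prod_cons, Equiv.Perm.mul_apply, ih, signedConj_apply]
    simp only [h, rightInvSeq, List.count_cons, wordProd_cons, beq_iff_eq]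
    ext
    · simp [mul_assoc]
    · split_ifs <;> simp [add_assoc]

theorem prod_map_signedConj_reverse_alternatingWord (i j : B) (p : ℕ) :
    ((alternatingWord j i (2 * p)).reverse.map cs.signedConj).prod =
      (cs.signedConj i * cs.signedConj j) ^ p := by
  induction p with
  | zero => simp [alternatingWord]
  | succ p ih =>
    rw [show 2 * (p + 1) = 2 * p + 1 + 1 by ring, alternatingWord_succ, alternatingWord_succ]
    simp only [List.concat_eq_append, List.reverse_append, List.reverse_cons, List.reverse_nil,
      List.nil_append, List.singleton_append, List.map_cons, List.prod_cons, ih, pow_succ',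
      mul_assoc]

theorem leftInvSeq_alternatingWord (i j : B) (p : ℕ) :
    cs.leftInvSeq (alternatingWord j i (2 * p)) =
      (List.range (2 * p)).map fun k ↦ cs.simple j * (cs.simple i * cs.simple j) ^ k := by
  apply List.ext_getElem
  · simp
  · intro k h₁ h₂
    rw [cs.getElem_leftInvSeq_alternatingWord j i p k (by simpa using h₁),
      prod_alternatingWord_eq_mul_pow]
    have : ¬ Even (2 * k + 1) := by simp
    have h : (2 * k + 1) / 2 = k := by omega
    simp [this, h]

theorem isLiftable_signedConj : M.IsLiftable cs.signedConj := by
  classical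
  intro i j
  rw [← prod_map_signedConj_reverse_alternatingWord]
  ext1 ⟨t, e⟩
  have hp : cs.wordProd (alternatingWord j i (2 * M i j)).reverse = 1 := by
    rw [wordProd_reverse, prod_alternatingWord_eq_mul_pow]
    simp
  have hc : (((cs.leftInvSeq (alternatingWord j i (2 * M i j))).count t : ℕ) : ZMod 2) = 0 := by
    rw [leftInvSeq_alternatingWord, two_mul, List.range_add, List.map_append, List.map_map,
      List.count_append]
    have : ((fun k ↦ cs.simple j * (cs.simple i * cs.simple j) ^ k) ∘ fun x ↦ M i j + x) =
        fun k ↦ cs.simple j * (cs.simple i * cs.simple j) ^ k := by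
      funext k
      simp [pow_add]
    rw [this, Nat.cast_add, CharTwo.add_self_eq_zero]
  rw [prod_map_signedConj_apply, hp, rightInvSeq_reverse, List.count_reverse, hc]
  simp

/-- The action of `W` on `W × ZMod 2` lifting `signedConj`. -/
noncomputable def signedConjHom : W →* Equiv.Perm (W × ZMod 2) :=
  cs.lift ⟨cs.signedConj, cs.isLiftable_signedConj⟩

theorem signedConjHom_simple (i : B) : cs.signedConjHom (cs.simple i) = cs.signedConj i :=
  cs.lift_apply_simple cs.isLiftable_signedConj i

open scoped Classical in
theorem signedConjHom_wordProd_apply (ω : List B) (t : W) (e : ZMod 2) :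
    cs.signedConjHom (cs.wordProd ω) (t, e) =
      (cs.wordProd ω * t * (cs.wordProd ω)⁻¹, e + ((cs.rightInvSeq ω).count t : ℕ)) := by
  rw [← prod_map_signedConj_apply, wordProd, map_list_prod, List.map_map]
  congr 3
  exact funext cs.signedConjHom_simple

/-- The parity of the number of occurrences of `t` in the right inversion sequence of any word
for `w`. -/
noncomputable def inversionParity (w t : W) : ZMod 2 := (cs.signedConjHom w (t, 0)).2

open scoped Classical in
theorem inversionParity_wordProd (ω : List B) (t : W) :
    cs.inversionParity (cs.wordProd ω) t = ((cs.rightInvSeq ω).count t : ℕ) := by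
  simp [inversionParity, signedConjHom_wordProd_apply]

theorem signedConjHom_apply (w t : W) (e : ZMod 2) :
    cs.signedConjHom w (t, e) = (w * t * w⁻¹, e + cs.inversionParity w t) := by
  classical
  obtain ⟨ω, rfl⟩ := cs.wordProd_surjective w
  rw [inversionParity_wordProd, signedConjHom_wordProd_apply]

theorem inversionParity_mul (a b t : W) :
    cs.inversionParity (a * b) t =
      cs.inversionParity b t + cs.inversionParity a (b * t * b⁻¹) := by
  have h : cs.signedConjHom (a * b) (t, 0) = cs.signedConjHom a (cs.signedConjHom b (t, 0)) := by
    rw [map_mul, Equiv.Perm.mul_apply]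
  simp only [signedConjHom_apply, zero_add] at h
  exact congrArg Prod.snd h

theorem inversionParity_simple_self (i : B) :
    cs.inversionParity (cs.simple i) (cs.simple i) = 1 := by
  simp [inversionParity, signedConjHom_simple, signedConj_apply]

theorem inversionParity_one (t : W) : cs.inversionParity 1 t = 0 := by
  simp [inversionParity]

theorem IsReflection.inversionParity_self {cs : CoxeterSystem M W} {t : W}
    (ht : cs.IsReflection t) : cs.inversionParity t t = 1 := by
  obtain ⟨v, i, rfl⟩ := ht
  have h := cs.inversionParity_mul v v⁻¹ (v * cs.simple i * v⁻¹)
  rw [mul_inv_cancel, inversionParity_one] at h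
  have e : v⁻¹ * (v * cs.simple i * v⁻¹) * v⁻¹⁻¹ = cs.simple i := by group
  rw [e] at h
  rw [inversionParity_mul, inversionParity_mul, e, mul_inv_cancel_right,
    inversionParity_simple_self, add_left_comm, ← h, add_zero]

theorem mem_rightInvSeq_of_inversionParity_ne_zero {ω : List B} {t : W}
    (h : cs.inversionParity (cs.wordProd ω) t ≠ 0) : t ∈ cs.rightInvSeq ω := by
  classical
  by_contra hn
  rw [inversionParity_wordProd, List.count_eq_zero_of_not_mem hn] at h
  simp at h

/-- The strong exchange property, for arbitrary words. -/
theorem IsRightInversion.mem_rightInvSeq {cs : CoxeterSystem M W} {ω : List B} {t : W}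
    (h : cs.IsRightInversion (cs.wordProd ω) t) : t ∈ cs.rightInvSeq ω := by
  apply cs.mem_rightInvSeq_of_inversionParity_ne_zero
  intro h0
  obtain ⟨ht, hlt⟩ := h
  obtain ⟨ω', hω', he⟩ := cs.exists_isReduced (cs.wordProd ω * t)
  have h1 : cs.inversionParity (cs.wordProd ω') t ≠ 0 := by
    rw [← he, inversionParity_mul, ht.inversionParity_self, mul_inv_cancel_right, h0]
    simp
  have h2 := (cs.isRightInversion_of_mem_rightInvSeq hω'
    (cs.mem_rightInvSeq_of_inversionParity_ne_zero h1)).2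
  rw [← he, mul_assoc, ht.mul_self, mul_one] at h2
  omega

theorem IsRightInversion.exists_eraseIdx {cs : CoxeterSystem M W} {ω : List B} {t : W}
    (h : cs.IsRightInversion (cs.wordProd ω) t) :
    ∃ j < ω.length, cs.wordProd ω * t = cs.wordProd (ω.eraseIdx j) := by
  obtain ⟨j, hj, rfl⟩ := List.mem_iff_getElem.1 h.mem_rightInvSeq
  refine ⟨j, by simpa using hj, ?_⟩
  rw [← wordProd_mul_getD_rightInvSeq, List.getD_eq_getElem _ _ hj]

/-! ### The Bruhat order -/

/-- The generating relation of the Bruhat order. -/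
def bruhatStep (a b : W) : Prop :=
  (∃ t : W, cs.IsReflection t ∧ b = a * t) ∧ cs.length a < cs.length b

variable {cs}

theorem bruhatStep.le {a b : W} (h : cs.bruhatStep a b) : cs.bruhatLE a b :=
  Relation.ReflTransGen.single h

theorem bruhatLE.refl (a : W) : cs.bruhatLE a a := Relation.ReflTransGen.refl

theorem bruhatLE.trans {a b c : W} (h₁ : cs.bruhatLE a b) (h₂ : cs.bruhatLE b c) :
    cs.bruhatLE a c := Relation.ReflTransGen.trans h₁ h₂

theorem bruhatLE.eq_or_length_lt {a b : W} (h : cs.bruhatLE a b) :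
    a = b ∨ cs.length a < cs.length b := by
  induction h with
  | refl => exact .inl rfl
  | tail _ h ih =>
    obtain rfl | ih := ih
    · exact .inr h.2
    · exact .inr (ih.trans h.2)

theorem bruhatLE.antisymm {a b : W} (h₁ : cs.bruhatLE a b) (h₂ : cs.bruhatLE b a) : a = b := by
  have := h₁.eq_or_length_lt
  have := h₂.eq_or_length_lt
  grind

theorem bruhatStep.inv {a b : W} (h : cs.bruhatStep a b) : cs.bruhatStep a⁻¹ b⁻¹ := by
  obtain ⟨⟨t, ht, rfl⟩, hl⟩ := h
  refine ⟨⟨a * t * a⁻¹, ht.conj a, ?_⟩, by simpa only [length_inv] using hl⟩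
  rw [mul_inv_rev, ht.inv]
  group

theorem bruhatLE.inv {a b : W} (h : cs.bruhatLE a b) : cs.bruhatLE a⁻¹ b⁻¹ :=
  by
  induction h with
  | refl => exact .refl _
  | tail _ h ih => exact ih.trans (bruhatStep.inv h).le

theorem bruhatStep_mul_simple {a : W} {i : B} (h : cs.length a < cs.length (a * cs.simple i)) :
    cs.bruhatStep a (a * cs.simple i) :=
  ⟨⟨_, cs.isReflection_simple i, rfl⟩, h⟩

theorem bruhatStep.mul_simple {a b : W} (h : cs.bruhatStep a b) (i : B) :
    b = a * cs.simple i ∨ cs.bruhatStep (a * cs.simple i) (b * cs.simple i) := by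
  obtain ⟨⟨t, ht, rfl⟩, hl⟩ := h
  have hr : cs.IsReflection (cs.simple i * t * cs.simple i) := by
    simpa using ht.conj (cs.simple i)
  have he : a * t * cs.simple i =
      a * cs.simple i * (cs.simple i * t * cs.simple i) := by simp [mul_assoc]
  by_contra! hcon
  obtain ⟨hne, hstep⟩ := hcon
  have hlen : cs.length (a * t * cs.simple i) < cs.length (a * cs.simple i) := by
    by_contra! hge
    exact hstep ⟨⟨_, hr, he⟩, hge.lt_of_ne fun h ↦ hr.length_mul_left_ne (a * cs.simple i)
      (by rw [← he, h])⟩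
  have h₁ := cs.length_mul_simple a i
  have h₂ := cs.length_mul_simple (a * t) i
  obtain ⟨ω, hω, heω⟩ := cs.exists_isReduced (a * t * cs.simple i)
  have hb : a * t = cs.wordProd (ω ++ [i]) := by
    simp [wordProd_append, ← heω]
  have hatt : a * t * t = a := by rw [mul_assoc, ht.mul_self, mul_one]
  have hinv : cs.IsRightInversion (cs.wordProd (ω ++ [i])) t := ⟨ht, by rwa [← hb, hatt]⟩
  obtain ⟨j, hj, hje⟩ := hinv.exists_eraseIdx
  rw [← hb, hatt] at hje
  have hωl : ω.length = cs.length (a * t * cs.simple i) := by rw [heω, hω.eq]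
  rcases lt_or_ge j ω.length with hlt | hge
  · rw [List.eraseIdx_append_of_lt_length hlt, wordProd_append, wordProd_singleton] at hje
    have h₃ : a * cs.simple i = cs.wordProd (ω.eraseIdx j) := by simp [hje]
    have h₄ := cs.length_wordProd_le (ω.eraseIdx j)
    rw [← h₃, List.length_eraseIdx_of_lt hlt] at h₄
    omega
  · rw [List.eraseIdx_append_of_length_le hge] at hje
    have : j - ω.length = 0 := by simp at hj; omega
    rw [this] at hje
    have h₃ : a = a * t * cs.simple i := by simpa [heω] using hje
    have h₄ := congrArg (· * cs.simple i) h₃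
    exact hne (by simpa using h₄.symm)

theorem bruhatLE.mul_simple {x y : W} (h : cs.bruhatLE x y) (i : B) :
    cs.bruhatLE (x * cs.simple i) (y * cs.simple i) ∨ cs.bruhatLE (x * cs.simple i) y := by
  induction h using Relation.ReflTransGen.head_induction_on with
  | refl => exact .inl (.refl _)
  | head hs hle ih =>
    rcases bruhatStep.mul_simple hs i with rfl | hs'
    · exact .inr hle
    · exact ih.imp hs'.le.trans hs'.le.trans

theorem bruhatLE.mul_simple_or_le_mul_simple {x y : W} (h : cs.bruhatLE x y) (i : B) :
    cs.bruhatLE (x * cs.simple i) (y * cs.simple i) ∨ cs.bruhatLE x (y * cs.simple i) := by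
  induction h with
  | refl => exact .inl (.refl _)
  | tail hle hs ih =>
    rcases bruhatStep.mul_simple hs i with rfl | hs'
    · exact .inr (by rwa [simple_mul_simple_cancel_right])
    · exact ih.imp (·.trans hs'.le) (·.trans hs'.le)

/-- One half of the subword property. -/
theorem bruhatLE.exists_sublist {x : W} {ω : List B} (h : cs.bruhatLE x (cs.wordProd ω)) :
    ∃ ω', ω'.Sublist ω ∧ x = cs.wordProd ω' := by
  induction h using Relation.ReflTransGen.head_induction_on with
  | refl => exact ⟨ω, .refl _, rfl⟩
  | @head a _ hs _ ih =>
    obtain ⟨ω', hω', rfl⟩ := ih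
    obtain ⟨⟨t, ht, he⟩, hl⟩ := hs
    have ha : a = cs.wordProd ω' * t := by rw [he, mul_assoc, ht.mul_self, mul_one]
    obtain ⟨j, -, hj⟩ := IsRightInversion.exists_eraseIdx (cs := cs) ⟨ht, ha ▸ hl⟩
    exact ⟨_, (List.eraseIdx_sublist _ _).trans hω', ha.trans hj⟩

/-- The other half of the subword property. -/
theorem IsReduced.bruhatLE_of_sublist {ω ω' : List B} (hω : cs.IsReduced ω)
    (h : ω'.Sublist ω) : cs.bruhatLE (cs.wordProd ω') (cs.wordProd ω) := by
  induction ω using List.reverseRecOn generalizing ω' with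
  | nil => rw [List.sublist_nil.1 h]; exact .refl _
  | append_singleton ω i ih =>
    have hω₀ : cs.IsReduced ω := by simpa using hω.take ω.length
    have hle : cs.bruhatLE (cs.wordProd ω) (cs.wordProd (ω ++ [i])) := by
      rw [wordProd_append, wordProd_singleton]
      apply (bruhatStep_mul_simple _).le
      rw [← wordProd_singleton, ← wordProd_append, hω.eq, hω₀.eq]
      simp
    obtain ⟨ω₁, ω₂, rfl, h₁, h₂⟩ := List.sublist_append_iff.1 h
    have h₁' := ih hω₀ h₁
    rcases List.sublist_singleton.1 h₂ with rfl | rfl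
    · simpa using h₁'.trans hle
    · have := h₁'.mul_simple i
      simp only [wordProd_append, wordProd_singleton] at hle ⊢
      exact this.elim id (·.trans hle)

/-! ### Parabolic subgroups and double cosets -/

theorem bruhatLE.mul_of_mem_parabolic_right {J : Set B} {w z v : W}
    (hw : ∀ j ∈ J, cs.length w < cs.length (w * cs.simple j)) (hv : v ∈ cs.parabolic J)
    (h : cs.bruhatLE w z) : cs.bruhatLE w (z * v) := by
  have step : ∀ z, cs.bruhatLE w z → ∀ j ∈ J, cs.bruhatLE w (z * cs.simple j) :=
    fun z hz j hj ↦ (hz.mul_simple_or_le_mul_simple j).elim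
      (bruhatStep_mul_simple (hw j hj)).le.trans id
  induction hv using Subgroup.closure_induction_right with
  | one => simpa only [mul_one]
  | mul_right x _ y hy ih =>
    obtain ⟨j, hj, rfl⟩ := hy
    rw [← mul_assoc]
    exact step _ ih j hj
  | mul_inv_cancel x _ y hy ih =>
    obtain ⟨j, hj, rfl⟩ := hy
    rw [← mul_assoc, inv_simple]
    exact step _ ih j hj

theorem bruhatLE.mul_of_mem_parabolic_left {I : Set B} {w z u : W}
    (hw : ∀ i ∈ I, cs.length w < cs.length (cs.simple i * w)) (hu : u ∈ cs.parabolic I)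
    (h : cs.bruhatLE w z) : cs.bruhatLE w (u * z) := by
  have hw' : ∀ i ∈ I, cs.length w⁻¹ < cs.length (w⁻¹ * cs.simple i) := fun i hi ↦ by
    simpa [← cs.length_inv (w⁻¹ * _)] using hw i hi
  simpa using (h.inv.mul_of_mem_parabolic_right hw' (inv_mem hu)).inv

theorem simple_mem_parabolic {I : Set B} {i : B} (hi : i ∈ I) : cs.simple i ∈ cs.parabolic I :=
  Subgroup.subset_closure ⟨i, hi, rfl⟩

theorem wordProd_mem_parabolic {I : Set B} {ω : List B} (h : ∀ i ∈ ω, i ∈ I) :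
    cs.wordProd ω ∈ cs.parabolic I := by
  induction ω with
  | nil => simp
  | cons i ω ih =>
    rw [wordProd_cons]
    exact mul_mem (simple_mem_parabolic (h i (by simp))) (ih fun j hj ↦ h j (by simp [hj]))

theorem exists_wordProd_of_mem_parabolic {I : Set B} {u : W} (hu : u ∈ cs.parabolic I) :
    ∃ ω : List B, (∀ i ∈ ω, i ∈ I) ∧ u = cs.wordProd ω := by
  have step : ∀ i ∈ I, ∀ x : W, (∃ ω : List B, (∀ i ∈ ω, i ∈ I) ∧ x = cs.wordProd ω) →
      ∃ ω : List B, (∀ i ∈ ω, i ∈ I) ∧ cs.simple i * x = cs.wordProd ω := by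
    rintro i hi _ ⟨ω, hω, rfl⟩
    exact ⟨i :: ω, by simpa [hi] using hω, by rw [wordProd_cons]⟩
  induction hu using Subgroup.closure_induction_left with
  | one => exact ⟨[], by simp⟩
  | mul_left x hx y _ ih =>
    obtain ⟨i, hi, rfl⟩ := hx
    exact step i hi _ ih
  | inv_mul_cancel x hx y _ ih =>
    obtain ⟨i, hi, rfl⟩ := hx
    rw [inv_simple]
    exact step i hi _ ih

theorem bruhatLE.mem_parabolic {I : Set B} {u' u : W} (h : cs.bruhatLE u' u)
    (hu : u ∈ cs.parabolic I) : u' ∈ cs.parabolic I := by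
  obtain ⟨ω, hω, rfl⟩ := exists_wordProd_of_mem_parabolic hu
  obtain ⟨ω', hω', rfl⟩ := h.exists_sublist
  exact wordProd_mem_parabolic fun i hi ↦ hω i (hω'.subset hi)

end CoxeterSystem

/-- Let `C = W_I w W_J` be a parabolic double coset with minimal-length element `w`,
let `y ∈ C`, and fix a reduced factorization `y = u w v` with `u ∈ W_I`, `v ∈ W_J`.
Then for every `x ∈ W` the following are equivalent: (i) `x ∈ C` and `x ≤ y`;
(ii) `w ≤ x ≤ y`; (iii) `x = u' w v'` for some `u' ≤ u` and `v' ≤ v` in Bruhat order. -/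
theorem double_coset_bruhat_interval_characterization
    [Fintype B] {M : CoxeterMatrix B} (cs : CoxeterSystem M W)
    (I J : Set B) (w : W)
    (hmin : ∀ x ∈ cs.doubleCoset I w J, x ≠ w → cs.length w < cs.length x)
    (y u v : W) (hu : u ∈ cs.parabolic I) (hv : v ∈ cs.parabolic J)
    (hy : y = u * w * v)
    (hred : cs.length y = cs.length u + cs.length w + cs.length v)
    (x : W) :
    ((x ∈ cs.doubleCoset I w J ∧ cs.bruhatLE x y) ↔
      (cs.bruhatLE w x ∧ cs.bruhatLE x y)) ∧
    ((x ∈ cs.doubleCoset I w J ∧ cs.bruhatLE x y) ↔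
      (∃ u' v' : W, cs.bruhatLE u' u ∧ cs.bruhatLE v' v ∧ x = u' * w * v')) := by
  obtain ⟨ωu, hωu, rfl⟩ := cs.exists_isReduced u
  obtain ⟨ωw, hωw, rfl⟩ := cs.exists_isReduced w
  obtain ⟨ωv, hωv, rfl⟩ := cs.exists_isReduced v
  set w := cs.wordProd ωw with hw
  have hy' : y = cs.wordProd (ωu ++ ωw ++ ωv) := by simp [hy, hw, wordProd_append, mul_assoc]
  have hω : cs.IsReduced (ωu ++ ωw ++ ωv) := by
    rw [CoxeterSystem.IsReduced, ← hy', hred, hωu.eq, hωw.eq, hωv.eq]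
    simp [add_assoc]
  have hwl : ∀ i ∈ I, cs.length w < cs.length (cs.simple i * w) := fun i hi ↦
    hmin _ ⟨_, simple_mem_parabolic hi, 1, one_mem _, by simp⟩ fun h ↦
      cs.length_simple_mul_ne w i (by rw [h])
  have hwr : ∀ j ∈ J, cs.length w < cs.length (w * cs.simple j) := fun j hj ↦
    hmin _ ⟨1, one_mem _, _, simple_mem_parabolic hj, by simp⟩ fun h ↦
      cs.length_mul_simple_ne w j (by rw [h])
  have h₁₂ : x ∈ cs.doubleCoset I w J → cs.bruhatLE w x := by
    rintro ⟨a, ha, b, hb, rfl⟩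
    exact ((bruhatLE.refl w).mul_of_mem_parabolic_left hwl ha).mul_of_mem_parabolic_right hwr hb
  have h₂₃ : cs.bruhatLE w x → cs.bruhatLE x y → ∃ u' v' : W,
      cs.bruhatLE u' (cs.wordProd ωu) ∧ cs.bruhatLE v' (cs.wordProd ωv) ∧ x = u' * w * v' := by
    intro hwx hxy
    obtain ⟨_, hs, rfl⟩ := bruhatLE.exists_sublist (hy' ▸ hxy)
    obtain ⟨_, ωv', rfl, hs, hsv⟩ := List.sublist_append_iff.1 hs
    obtain ⟨ωu', ωw', rfl, hsu, hsw⟩ := List.sublist_append_iff.1 hs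
    have hu' := hωu.bruhatLE_of_sublist hsu
    have hv' := hωv.bruhatLE_of_sublist hsv
    have hle := (hwx.mul_of_mem_parabolic_left hwl
      (inv_mem (hu'.mem_parabolic hu))).mul_of_mem_parabolic_right hwr
        (inv_mem (hv'.mem_parabolic hv))
    have hw' : w = cs.wordProd ωw' :=
      bruhatLE.antisymm (by simpa [wordProd_append, mul_assoc] using hle)
        (hωw.bruhatLE_of_sublist hsw)
    exact ⟨_, _, hu', hv', by rw [hw', wordProd_append, wordProd_append]⟩
  have h₃₁ : (∃ u' v' : W, cs.bruhatLE u' (cs.wordProd ωu) ∧ cs.bruhatLE v' (cs.wordProd ωv) ∧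
      x = u' * w * v') → x ∈ cs.doubleCoset I w J ∧ cs.bruhatLE x y := by
    rintro ⟨u', v', hu', hv', rfl⟩
    refine ⟨⟨u', hu'.mem_parabolic hu, v', hv'.mem_parabolic hv, rfl⟩, ?_⟩
    obtain ⟨ωu', hsu, rfl⟩ := hu'.exists_sublist
    obtain ⟨ωv', hsv, rfl⟩ := hv'.exists_sublist
    rw [hy', hw, ← wordProd_append, ← wordProd_append]
    exact hω.bruhatLE_of_sublist ((hsu.append (.refl _)).append hsv)
  exact ⟨⟨fun h ↦ ⟨h₁₂ h.1, h.2⟩, fun h ↦ h₃₁ (h₂₃ h.1 h.2)⟩,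
    ⟨fun h ↦ h₂₃ (h₁₂ h.1) h.2, h₃₁⟩⟩
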